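/- arXiv:1801.07627 — 5 statements merged into one kernel-verified Lean document; each statement's English description precedes it below -/
import Mathlib

section
/- Let (X₁, …, X_t) be a difference family in a finite abelian group G of order v with parameter set (v; k₁, …, k_t; λ), set n = ∑_{i=1}^t k_i − λ, and let f_i = f_{X_i} be the associated ±1-valued functions. Then in the complex group algebra of G, ∑_{i=1}^t N(a_{f_i}) = 4n·e + (tv − 4n)·G, where G denotes the sum of all elements of G. -/
open Finset

/-- `(X₁,…,X_t)` is a difference family in `G` with index `lam`. -/
def IsDiffFamily {G : Type*} [CommGroup G] [Fintype G] [DecidableEq G] {t : ℕ}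
    (X : Fin t → Finset G) (lam : ℕ) : Prop :=
  (∀ i, (X i).Nonempty ∧ X i ≠ Finset.univ) ∧
  ∀ a : G, a ≠ 1 → ∑ i, ((X i).filter (fun x => a * x ∈ X i)).card = lam

/-- The ±1-valued function associated with `X ⊆ G`: value `−1` on `X`, `+1` off `X`. -/
def assocFun {G : Type*} [DecidableEq G] (X : Finset G) (x : G) : ℂ :=
  if x ∈ X then -1 else 1

/-- The element `a_f = ∑_{x∈G} f(x)·x` of the complex group algebra of `G`. -/
noncomputable def aElem {G : Type*} [CommGroup G] [Fintype G] (f : G → ℂ) :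
    MonoidAlgebra ℂ G :=
  ∑ x : G, MonoidAlgebra.single x (f x)

lemma aElem_mul_aux {G : Type*} [CommGroup G] [Fintype G] (f g : G → ℂ) :
    aElem f * aElem g = ∑ y : G, MonoidAlgebra.single y (∑ x : G, f x * g (x⁻¹ * y)) := by
  have hs : ∀ y : G, MonoidAlgebra.single y (∑ x : G, f x * g (x⁻¹ * y)) =
      ∑ x : G, MonoidAlgebra.single y (f x * g (x⁻¹ * y)) := by
    intro y
    exact map_sum (MonoidAlgebra.singleAddHom y) _ _
  simp only [hs]
  rw [Finset.sum_comm]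
  unfold aElem
  rw [Finset.sum_mul_sum]
  refine Finset.sum_congr rfl fun x _ => ?_
  refine Fintype.sum_equiv (Equiv.mulLeft x) _ _ fun z => ?_
  simp [MonoidAlgebra.single_mul_single]

lemma corr_aux {G : Type*} [CommGroup G] [Fintype G] [DecidableEq G] (X : Finset G) (y : G) :
    ∑ x : G, assocFun X x * (starRingEnd ℂ) (assocFun X (x⁻¹ * y)⁻¹) =
      (Fintype.card G : ℂ) - 4 * (X.card : ℂ)
        + 4 * ((X.filter (fun x => y * x ∈ X)).card : ℂ) := by
  have h1 : ∑ x : G, assocFun X x * (starRingEnd ℂ) (assocFun X (x⁻¹ * y)⁻¹) =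
      ∑ x : G, assocFun X (y * x) * assocFun X x := by
    symm
    refine Fintype.sum_equiv (Equiv.mulLeft y) _ _ fun z => ?_
    have : ((y * z)⁻¹ * y)⁻¹ = z := by simp
    simp only [Equiv.coe_mulLeft, this]
    congr 1
    unfold assocFun
    split_ifs <;> simp
  have h2 : ∀ x : G, assocFun X (y * x) * assocFun X x =
      1 - 2 * (if y * x ∈ X then (1 : ℂ) else 0) - 2 * (if x ∈ X then (1 : ℂ) else 0)
        + 4 * (if x ∈ X ∧ y * x ∈ X then (1 : ℂ) else 0) := by
    intro x
    unfold assocFun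
    by_cases ha : y * x ∈ X <;> by_cases hb : x ∈ X <;> simp [ha, hb] <;> norm_num
  have h3 : ∑ x : G, (if y * x ∈ X then (1 : ℂ) else 0) = (X.card : ℂ) := by
    have h5 : ∑ x : G, (if y * x ∈ X then (1 : ℂ) else 0) =
        ∑ x : G, (if x ∈ X then (1 : ℂ) else 0) :=
      Fintype.sum_equiv (Equiv.mulLeft y) _ _ (fun z => rfl)
    rw [h5]
    simp
  have h4 : ∑ x : G, (if x ∈ X ∧ y * x ∈ X then (1 : ℂ) else 0) =
      ((X.filter (fun x => y * x ∈ X)).card : ℂ) := by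
    rw [Finset.sum_boole]
    congr 2
    ext x
    simp
  rw [h1]
  simp only [h2, Finset.sum_add_distrib, Finset.sum_sub_distrib, ← Finset.mul_sum, h3, h4]
  simp
  ring

/-- For a difference family `(X₁,…,X_t)` with parameter set `(v;k₁,…,k_t;λ)` and
`n = ∑ kᵢ − λ`, the associated ±1 functions satisfy
`∑ᵢ N(a_{fᵢ}) = 4n·e + (tv − 4n)·G` in the group algebra, where
`N(a) = a·a*` and `a_f* = ∑ conj(f(x))·x⁻¹`. -/
theorem diff_family_norm_sum {G : Type*} [CommGroup G] [Fintype G] [DecidableEq G] {t : ℕ}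
    (X : Fin t → Finset G) (lam : ℕ) (h : IsDiffFamily X lam) :
    ∑ i, aElem (assocFun (X i)) *
        aElem (fun x => (starRingEnd ℂ) (assocFun (X i) x⁻¹)) =
      (4 * ((∑ i, ((X i).card : ℂ)) - (lam : ℂ))) • MonoidAlgebra.single (1 : G) (1 : ℂ) +
        ((t : ℂ) * (Fintype.card G : ℂ) - 4 * ((∑ i, ((X i).card : ℂ)) - (lam : ℂ))) •
          ∑ x : G, MonoidAlgebra.single x (1 : ℂ) := by
  simp only [aElem_mul_aux, corr_aux]
  rw [Finset.sum_comm]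
  have hs : ∀ y : G, ∑ i, MonoidAlgebra.single y ((Fintype.card G : ℂ) - 4 * ((X i).card : ℂ)
        + 4 * (((X i).filter (fun x => y * x ∈ X i)).card : ℂ)) =
      MonoidAlgebra.single y (((t : ℂ) * (Fintype.card G : ℂ)
          - 4 * ((∑ i, ((X i).card : ℂ)) - (lam : ℂ)))) +
        if y = 1 then MonoidAlgebra.single (1 : G)
          (4 * ((∑ i, ((X i).card : ℂ)) - (lam : ℂ))) else 0 := by
    intro y
    have hm : ∀ c : Fin t → ℂ, ∑ i, MonoidAlgebra.single y (c i) =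
        MonoidAlgebra.single y (∑ i, c i) := fun c =>
      (map_sum (MonoidAlgebra.singleAddHom y) _ _).symm
    rw [hm, Finset.sum_add_distrib, Finset.sum_sub_distrib, ← Finset.mul_sum, ← Finset.mul_sum]
    by_cases hy : y = 1
    · subst hy
      rw [if_pos rfl, ← MonoidAlgebra.single_add]
      congr 1
      simp
    · have hl : ∑ i, (((X i).filter (fun x => y * x ∈ X i)).card : ℂ) = (lam : ℂ) := by
        exact_mod_cast h.2 y hy
      rw [if_neg hy, hl, add_zero]
      congr 1
      simp
      ring
  simp only [hs, Finset.sum_add_distrib]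
  rw [add_comm]
  congr 1
  · simp [MonoidAlgebra.smul_single]
  · simp [Finset.smul_sum, MonoidAlgebra.smul_single]
end

section
/- Let (X₁, …, X_t) be a difference family in a finite abelian group G of order v with parameter set (v; k₁, …, k_t; λ), and set n = ∑_{i=1}^t k_i − λ. Then the associated functions f_i = f_{X_i} : G → {±1} are non-constant complementary functions with paf-constants α₀ = tv and α = tv − 4n. -/
open Finset

/-- The periodic autocorrelation function `paf_f(x) = ∑_{y∈G} f(xy)·conj(f(y))`. -/
noncomputable def paf {G : Type*} [CommGroup G] [Fintype G] (f : G → ℂ) (x : G) : ℂ :=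
  ∑ y : G, f (x * y) * (starRingEnd ℂ) (f y)

/-- `f₁,…,f_t` are complementary with paf-constants `α₀, α`. -/
def Complementary {G : Type*} [CommGroup G] [Fintype G] {t : ℕ} (f : Fin t → G → ℂ)
    (α₀ α : ℂ) : Prop :=
  (∑ i, paf (f i) (1 : G) = α₀) ∧ ∀ s : G, s ≠ 1 → ∑ i, paf (f i) s = α

/-- The autocorrelation of the function associated with `X` in terms of counts. -/
theorem paf_assocFun {G : Type*} [CommGroup G] [Fintype G] [DecidableEq G]
    (X : Finset G) (s : G) :
    paf (assocFun X) s = (Fintype.card G : ℂ) - 4 * (X.card : ℂ)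
      + 4 * ((X.filter (fun x => s * x ∈ X)).card : ℂ) := by
  have h1 : ∑ y : G, (if y ∈ X then (1 : ℂ) else 0) = X.card := by simp
  have h2 : ∑ y : G, (if s * y ∈ X then (1 : ℂ) else 0) = X.card := by
    rw [← h1]
    exact Equiv.sum_comp (Equiv.mulLeft s) (fun y => if y ∈ X then (1 : ℂ) else 0)
  have h3 : ∑ y : G, (if y ∈ X ∧ s * y ∈ X then (1 : ℂ) else 0)
      = (X.filter (fun x => s * x ∈ X)).card := by
    rw [Finset.sum_boole]
    congr 2
    ext y
    simp
  have h4 : ∀ y : G, assocFun X (s * y) * (starRingEnd ℂ) (assocFun X y)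
      = 1 - 2 * (if y ∈ X then (1 : ℂ) else 0) - 2 * (if s * y ∈ X then (1 : ℂ) else 0)
        + 4 * (if y ∈ X ∧ s * y ∈ X then (1 : ℂ) else 0) := by
    intro y
    unfold assocFun
    by_cases a : y ∈ X <;> by_cases b : s * y ∈ X <;> simp [a, b] <;> norm_num
  unfold paf
  simp only [h4, Finset.sum_add_distrib, Finset.sum_sub_distrib, ← Finset.mul_sum, h1, h2, h3]
  simp
  ring

/-- The functions associated with the blocks of a difference family with parameter set
`(v;k₁,…,k_t;λ)` are non-constant complementary functions with paf-constants
`α₀ = tv` and `α = tv − 4n`, where `n = ∑ kᵢ − λ`. -/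
theorem diff_family_assoc_complementary {G : Type*} [CommGroup G] [Fintype G]
    [DecidableEq G] {t : ℕ} (X : Fin t → Finset G) (lam : ℕ) (h : IsDiffFamily X lam) :
    (∀ i, ∃ x y : G, assocFun (X i) x ≠ assocFun (X i) y) ∧
    Complementary (fun i => assocFun (X i))
      ((t : ℂ) * (Fintype.card G : ℂ))
      ((t : ℂ) * (Fintype.card G : ℂ) - 4 * ((∑ i, ((X i).card : ℂ)) - (lam : ℂ))) := by
  obtain ⟨hX, hd⟩ := h
  refine ⟨fun i => ?_, ?_, fun s hs => ?_⟩
  · obtain ⟨⟨x, hx⟩, hne⟩ := hX i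
    obtain ⟨y, hy⟩ : ∃ y, y ∉ X i := by
      by_contra hc
      push Not at hc
      exact hne (Finset.eq_univ_iff_forall.2 hc)
    refine ⟨x, y, ?_⟩
    simp only [assocFun, hx, hy, if_true, if_false]
    norm_num
  · simp [paf_assocFun]
  · have hl : ∑ i, (((X i).filter (fun x => s * x ∈ X i)).card : ℂ) = lam := by
      rw [← hd s hs]
      push_cast
      rfl
    simp only [paf_assocFun, Finset.sum_add_distrib, Finset.sum_sub_distrib, ← Finset.mul_sum, hl]
    simp
    ring
end

section
/- Let (X₁, …, X_t) be a difference family in a finite abelian group G of order v with parameter set (v; k₁, …, k_t; λ) and n = ∑ k_i − λ. For each i, let A_i be the matrix with rows and columns indexed by G whose (x,y) entry is f_{X_i}(x·y⁻¹), where f_{X_i} is the ±1-valued function associated with X_i. Then ∑_{i=1}^t A_i·A_iᵀ = 4n·I_v + (tv − 4n)·J_v, where I_v is the identity matrix and J_v is the all-one matrix of order v. -/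
open Finset Matrix

/-- The ±1-valued function associated with `X ⊆ G`: value `−1` on `X`, `+1` off `X`. -/
def assocFunR {G : Type*} [DecidableEq G] (X : Finset G) (x : G) : ℝ :=
  if x ∈ X then -1 else 1

lemma assocFunR_autocorr {G : Type*} [CommGroup G] [Fintype G] [DecidableEq G]
    (X : Finset G) (x y : G) :
    ∑ z, assocFunR X (x * z⁻¹) * assocFunR X (y * z⁻¹) =
      (Fintype.card G : ℝ) - 4 * (X.card : ℝ) +
        4 * ((X.filter (fun w => x * y⁻¹ * w ∈ X)).card : ℝ) := by
  have h1 : ∑ z, assocFunR X (x * z⁻¹) * assocFunR X (y * z⁻¹) =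
      ∑ w, assocFunR X (x * y⁻¹ * w) * assocFunR X w := by
    apply Fintype.sum_equiv ((Equiv.inv G).trans (Equiv.mulLeft y))
    intro z
    simp [mul_assoc]
  have h2 : ∀ w, assocFunR X (x * y⁻¹ * w) * assocFunR X w =
      1 - 2 * (if w ∈ X then (1 : ℝ) else 0) - 2 * (if x * y⁻¹ * w ∈ X then (1 : ℝ) else 0)
        + 4 * (if w ∈ X then (if x * y⁻¹ * w ∈ X then (1 : ℝ) else 0) else 0) := by
    intro w
    unfold assocFunR
    split_ifs <;> norm_num
  have h3 : ∑ w, (if x * y⁻¹ * w ∈ X then (1 : ℝ) else 0) =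
      ∑ w, (if w ∈ X then (1 : ℝ) else 0) :=
    Fintype.sum_equiv (Equiv.mulLeft (x * y⁻¹)) _ _ (fun w => by simp [mul_assoc])
  have h4 : ∑ w, (if w ∈ X then (1 : ℝ) else 0) = X.card := by simp
  have h5 : ∑ w, (if w ∈ X then (if x * y⁻¹ * w ∈ X then (1 : ℝ) else 0) else 0) =
      ((X.filter (fun w => x * y⁻¹ * w ∈ X)).card : ℝ) := by
    rw [Finset.card_filter, Finset.sum_ite_mem, Finset.univ_inter]
    push_cast
    rfl
  rw [h1, Finset.sum_congr rfl (fun w _ => h2 w), Finset.sum_add_distrib,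
    Finset.sum_sub_distrib, Finset.sum_sub_distrib, ← Finset.mul_sum, ← Finset.mul_sum,
    ← Finset.mul_sum, h3, h4, h5]
  simp
  ring

/-- For a difference family `(X₁,…,X_t)` with parameter set `(v;k₁,…,k_t;λ)` and
`n = ∑ kᵢ − λ`, the `G`-invariant ±1 matrices `Aᵢ = [f_{Xᵢ}(x y⁻¹)]` satisfy
`∑ᵢ Aᵢ·Aᵢᵀ = 4n·I + (tv − 4n)·J`. -/
theorem diff_family_matrix_identity {G : Type*} [CommGroup G] [Fintype G] [DecidableEq G]
    {t : ℕ} (X : Fin t → Finset G) (lam : ℕ) (h : IsDiffFamily X lam) :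
    ∑ i, (Matrix.of fun x y : G => assocFunR (X i) (x * y⁻¹)) *
        (Matrix.of fun x y : G => assocFunR (X i) (x * y⁻¹))ᵀ =
      (4 * ((∑ i, ((X i).card : ℝ)) - (lam : ℝ))) • (1 : Matrix G G ℝ) +
        ((t : ℝ) * (Fintype.card G : ℝ) - 4 * ((∑ i, ((X i).card : ℝ)) - (lam : ℝ))) •
          Matrix.of (fun _ _ : G => (1 : ℝ)) := by
  ext x y
  rw [Matrix.sum_apply]
  simp only [Matrix.mul_apply, Matrix.transpose_apply, Matrix.of_apply, Matrix.add_apply,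
    Matrix.smul_apply, smul_eq_mul, assocFunR_autocorr, Finset.sum_add_distrib,
    Finset.sum_sub_distrib, ← Finset.mul_sum]
  by_cases hxy : x = y
  · subst hxy
    simp
  · have ha : x * y⁻¹ ≠ 1 := fun h' => hxy (mul_inv_eq_one.mp h')
    have hl := h.2 _ ha
    have hl' : ∑ i, (((X i).filter (fun w => x * y⁻¹ * w ∈ X i)).card : ℝ) = lam := by
      exact_mod_cast hl
    rw [hl', Matrix.one_apply_ne hxy]
    simp
    ring
end

section
/- Let (X₀, X₁, X₂, X₃) be a Goethals–Seidel family in a finite abelian group G of order v, i.e., a quadruple of subsets of G (trivial blocks ∅ and G allowed) whose associated ±1-valued functions f_i = f_{X_i} satisfy ∑_{i=0}^3 paf_{f_i}(s) = 4v for s = e and = 0 for s ≠ e. Let A_i = [f_i(x·y⁻¹)]_{x,y∈G} and let R = [r_{x,y}] with r_{x,y} = 1 if xy = e and 0 otherwise. Then the 4v×4v block matrix H with block rows (A₀, A₁R, A₂R, A₃R), (−A₁R, A₀, −A₃ᵀR, A₂ᵀR), (−A₂R, A₃ᵀR, A₀, −A₁ᵀR), (−A₃R, −A₂ᵀR, A₁ᵀR,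 A₀) satisfies H·Hᵀ = 4v·I_{4v}, i.e., H is a Hadamard matrix of order 4v. -/
open Finset Matrix

/-- The periodic autocorrelation function of a real-valued `f`. -/
def pafR {G : Type*} [Mul G] [Fintype G] (f : G → ℝ) (x : G) : ℝ :=
  ∑ y : G, f (x * y) * f y

/-- The `G`-invariant matrix `[f(x·y⁻¹)]_{x,y∈G}` of `f : G → ℝ`. -/
def matOf {G : Type*} [CommGroup G] [Fintype G] (f : G → ℝ) : Matrix G G ℝ :=
  Matrix.of fun x y : G => f (x * y⁻¹)

/-- Goethals–Seidel construction: if `(X₀,X₁,X₂,X₃)` is a Goethals–Seidel family in a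
finite abelian group `G` of order `v` (trivial blocks allowed), i.e. the associated ±1
functions `fᵢ = f_{Xᵢ}` satisfy `∑ᵢ paf_{fᵢ}(s) = 4v` for `s = e` and `= 0` for `s ≠ e`,
then plugging the matrices `Aᵢ = [fᵢ(x y⁻¹)]` and `R = [if xy = e then 1 else 0]` into
the Goethals–Seidel array yields a matrix `H` with `H·Hᵀ = 4v·I`, i.e. a Hadamard matrix
of order `4v`. -/
theorem goethals_seidel_hadamard {G : Type*} [CommGroup G] [Fintype G] [DecidableEq G]
    (X : Fin 4 → Finset G)
    (hGS1 : ∑ i, pafR (assocFunR (X i)) (1 : G) = 4 * Fintype.card G)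
    (hGS2 : ∀ s : G, s ≠ 1 → ∑ i, pafR (assocFunR (X i)) s = 0)
    (R : Matrix G G ℝ) (hR : ∀ x y : G, R x y = if x * y = 1 then 1 else 0)
    (A : Fin 4 → Matrix G G ℝ) (hA : ∀ i, A i = matOf (assocFunR (X i)))
    (H : Matrix (Fin 4 × G) (Fin 4 × G) ℝ)
    (hH : ∀ p q : Fin 4 × G,
      H p q =
        (![![A 0, A 1 * R, A 2 * R, A 3 * R],
           ![-(A 1 * R), A 0, -((A 3)ᵀ * R), (A 2)ᵀ * R],
           ![-(A 2 * R), (A 3)ᵀ * R, A 0, -((A 1)ᵀ * R)],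
           ![-(A 3 * R), -((A 2)ᵀ * R), (A 1)ᵀ * R, A 0]] p.1 q.1) p.2 q.2) :
    H * Hᵀ = (4 * (Fintype.card G : ℝ)) • (1 : Matrix (Fin 4 × G) (Fin 4 × G) ℝ) := by
  have hRT : Rᵀ = R := by
    ext x y
    simp [hR, mul_comm]
  have hRR : R * R = 1 := by
    ext x y
    simp only [Matrix.mul_apply, hR, Matrix.one_apply]
    rw [Finset.sum_eq_single x⁻¹]
    · simp [inv_mul_eq_one]
    · intro b _ hb
      have : x * b ≠ 1 := fun h => hb (eq_inv_of_mul_eq_one_right h)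
      simp [this]
    · simp
  have hRA : ∀ i, R * A i = (A i)ᵀ * R := by
    intro i
    ext x y
    simp only [Matrix.mul_apply, hR, Matrix.transpose_apply, hA, matOf, Matrix.of_apply]
    rw [Finset.sum_eq_single x⁻¹, Finset.sum_eq_single y⁻¹]
    · simp [mul_comm]
    · intro b _ hb
      have : b * y ≠ 1 := fun h => hb (eq_inv_of_mul_eq_one_left h)
      simp [this]
    · simp
    · intro b _ hb
      have : x * b ≠ 1 := fun h => hb (eq_inv_of_mul_eq_one_right h)
      simp [this]
    · simp
  have hRAT : ∀ i, R * (A i)ᵀ = A i * R := by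
    intro i
    calc R * (A i)ᵀ = R * ((A i)ᵀ * R) * R := by
          rw [Matrix.mul_assoc, Matrix.mul_assoc, hRR, Matrix.mul_one]
      _ = A i * R := by rw [← hRA, ← Matrix.mul_assoc, hRR, Matrix.one_mul]
  have hC : ∀ i j, A i * A j = A j * A i := by
    intro i j
    ext x y
    simp only [Matrix.mul_apply, hA, matOf, Matrix.of_apply]
    refine Fintype.sum_equiv ((Equiv.inv G).trans (Equiv.mulLeft (x * y))) _ _ ?_
    intro z
    simp only [Equiv.trans_apply, Equiv.inv_apply, Equiv.coe_mulLeft]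
    rw [mul_comm]
    congr 2
    · rw [mul_inv, mul_inv, inv_inv, show x * (x⁻¹ * y⁻¹ * z) = z * y⁻¹ * (x * x⁻¹) by ac_rfl]
      simp
    · rw [show x * y * z⁻¹ * y⁻¹ = x * z⁻¹ * (y * y⁻¹) by ac_rfl]
      simp
  have hCT : ∀ i j, (A i)ᵀ * (A j)ᵀ = (A j)ᵀ * (A i)ᵀ := by
    intro i j
    rw [← Matrix.transpose_mul, hC, Matrix.transpose_mul]
  have hCM : ∀ i j, A i * (A j)ᵀ = (A j)ᵀ * A i := by
    intro i j
    ext x y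
    simp only [Matrix.mul_apply, hA, matOf, Matrix.of_apply, Matrix.transpose_apply]
    refine Fintype.sum_equiv ((Equiv.inv G).trans (Equiv.mulLeft (x * y))) _ _ ?_
    intro z
    simp only [Equiv.trans_apply, Equiv.inv_apply, Equiv.coe_mulLeft]
    rw [mul_comm]
    congr 2
    · rw [show x * y * z⁻¹ * x⁻¹ = y * z⁻¹ * (x * x⁻¹) by ac_rfl]
      simp
    · rw [show x * y * z⁻¹ * y⁻¹ = x * z⁻¹ * (y * y⁻¹) by ac_rfl]
      simp
  have hS : (A 0)ᵀ * A 0 + (A 1)ᵀ * A 1 + (A 2)ᵀ * A 2 + (A 3)ᵀ * A 3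
      = (4 * (Fintype.card G : ℝ)) • (1 : Matrix G G ℝ) := by
    have hp : ∀ i x y, ((A i)ᵀ * A i) x y = pafR (assocFunR (X i)) (x * y⁻¹) := by
      intro i x y
      rw [← hCM]
      simp only [Matrix.mul_apply, hA, matOf, Matrix.of_apply, Matrix.transpose_apply, pafR]
      refine Fintype.sum_equiv ((Equiv.inv G).trans (Equiv.mulLeft y)) _ _ ?_
      intro z
      simp only [Equiv.trans_apply, Equiv.inv_apply, Equiv.coe_mulLeft]
      congr 2
      simp [mul_assoc]
    ext x y
    have h4 : ∑ i, pafR (assocFunR (X i)) (x * y⁻¹)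
        = ((4 * (Fintype.card G : ℝ)) • (1 : Matrix G G ℝ)) x y := by
      by_cases h : x = y
      · subst h
        simpa using hGS1
      · rw [hGS2 _ (fun h' => h (mul_inv_eq_one.mp h'))]
        simp [h]
    rw [← h4, Fin.sum_univ_four]
    simp only [Matrix.add_apply, hp]
  have hRA' : ∀ i (Z : Matrix G G ℝ), R * (A i * Z) = (A i)ᵀ * (R * Z) := by
    intro i Z
    rw [← Matrix.mul_assoc, hRA, Matrix.mul_assoc]
  have hRAT' : ∀ i (Z : Matrix G G ℝ), R * ((A i)ᵀ * Z) = A i * (R * Z) := by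
    intro i Z
    rw [← Matrix.mul_assoc, hRAT, Matrix.mul_assoc]
  have hC' : ∀ i j (Z : Matrix G G ℝ), A i * (A j * Z) = A j * (A i * Z) := by
    intro i j Z
    rw [← Matrix.mul_assoc, hC, Matrix.mul_assoc]
  have hCT' : ∀ i j (Z : Matrix G G ℝ), (A i)ᵀ * ((A j)ᵀ * Z) = (A j)ᵀ * ((A i)ᵀ * Z) := by
    intro i j Z
    rw [← Matrix.mul_assoc, hCT, Matrix.mul_assoc]
  have hCM' : ∀ i j (Z : Matrix G G ℝ), A i * ((A j)ᵀ * Z) = (A j)ᵀ * (A i * Z) := by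
    intro i j Z
    rw [← Matrix.mul_assoc, hCM, Matrix.mul_assoc]
  obtain ⟨M, hM⟩ : ∃ M : Fin 4 → Fin 4 → Matrix G G ℝ, M =
      ![![A 0, A 1 * R, A 2 * R, A 3 * R],
           ![-(A 1 * R), A 0, -((A 3)ᵀ * R), (A 2)ᵀ * R],
           ![-(A 2 * R), (A 3)ᵀ * R, A 0, -((A 1)ᵀ * R)],
           ![-(A 3 * R), -((A 2)ᵀ * R), (A 1)ᵀ * R, A 0]] := ⟨_, rfl⟩
  rw [← hM] at hH
  have key : ∀ i j, ∑ k, M i k * (M j k)ᵀ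
      = if i = j then (4 * (Fintype.card G : ℝ)) • (1 : Matrix G G ℝ) else 0 := by
    intro i j
    rw [← hS, hM]
    fin_cases i <;> fin_cases j <;>
      simp [Fin.sum_univ_four, Matrix.transpose_mul, hRT, Matrix.mul_assoc, hRA, hRAT, hRA',
        hRAT', hRR, hCM, hCM'] <;>
      (try simp only [hC, hC', hCT, hCT']) <;> abel
  ext ⟨i, x⟩ ⟨j, y⟩
  have := congrFun (congrFun (key i j) x) y
  simp only [Matrix.mul_apply, Matrix.transpose_apply, hH, Fintype.sum_prod_type]
  simp only [Matrix.sum_apply, Matrix.mul_apply, Matrix.transpose_apply] at this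
  rw [this]
  by_cases h : i = j
  · subst h
    simp [Matrix.one_apply]
  · simp [Matrix.one_apply, h]
end

section
/- Let G be a finite abelian group of order v and let (X₀, X₁, X₂, X₃) be a Goethals–Seidel family in G (trivial blocks allowed) with block sizes satisfying 0 = k₀ ≤ k₁ ≤ k₂ ≤ k₃ ≤ v/2, that is, a quadruple of subsets with parameters (v; k₀, k₁, k₂, k₃; λ) satisfying ∑_{i=0}^3 k_i = λ + v and, when v ≥ 2, ∑_{i=1}^3 k_i(k_i − 1) = λ(v − 1). Then ∑_{i=1}^3 (v/2 − k_i)² = (v/4)(4 − v), and consequently v ≤ 4. -/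
open Finset

/-- For a Goethals–Seidel family `(X₀,X₁,X₂,X₃)` in a finite abelian group `G` of order
`v` (trivial blocks allowed; `λ` may be negative) with block sizes
`0 = k₀ ≤ k₁ ≤ k₂ ≤ k₃ ≤ v/2`, parameters satisfying the counting condition,
`∑ kᵢ = λ + v`, and—when `v ≥ 2`—`∑_{i=1}^3 kᵢ(kᵢ−1) = λ(v−1)`, one has
`∑_{i=1}^3 (v/2 − kᵢ)² = (v/4)(4 − v)`, and consequently `v ≤ 4`. -/
theorem goethals_seidel_v_le_four {G : Type*} [CommGroup G] [Fintype G] [DecidableEq G]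
    (X : Fin 4 → Finset G) (lam : ℤ)
    (hcount : ∀ a : G, a ≠ 1 →
      (∑ i, ((X i).filter (fun x => a * x ∈ X i)).card : ℤ) = lam)
    (hk0 : (X 0).card = 0)
    (hord : (X 0).card ≤ (X 1).card ∧ (X 1).card ≤ (X 2).card ∧ (X 2).card ≤ (X 3).card)
    (hhalf : 2 * (X 3).card ≤ Fintype.card G)
    (hGS : ∑ i, ((X i).card : ℤ) = lam + Fintype.card G)
    (hfisher : 2 ≤ Fintype.card G →
      ∑ i : Fin 3, ((X i.succ).card : ℤ) * ((X i.succ).card - 1) =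
        lam * ((Fintype.card G : ℤ) - 1)) :
    (∑ i : Fin 3, ((Fintype.card G : ℚ) / 2 - ((X i.succ).card : ℚ)) ^ 2 =
      (Fintype.card G : ℚ) / 4 * (4 - (Fintype.card G : ℚ))) ∧
    Fintype.card G ≤ 4 := by
  have hpos : 0 < Fintype.card G := Fintype.card_pos
  have key : ∑ i : Fin 3, ((Fintype.card G : ℚ) / 2 - ((X i.succ).card : ℚ)) ^ 2 =
      (Fintype.card G : ℚ) / 4 * (4 - (Fintype.card G : ℚ)) := by
    have e2 : (1 : Fin 3).succ = (2 : Fin 4) := rfl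
    have e3 : (2 : Fin 3).succ = (3 : Fin 4) := rfl
    have e1 : (0 : Fin 3).succ = (1 : Fin 4) := rfl
    rw [Fin.sum_univ_three] at hfisher ⊢
    rw [Fin.sum_univ_four, hk0] at hGS
    rw [e1, e2, e3] at hfisher ⊢
    obtain ⟨_, h12, h23⟩ := hord
    generalize (X 1).card = a at *
    generalize (X 2).card = b at *
    generalize (X 3).card = c at *
    generalize Fintype.card G = v at *
    by_cases hv : 2 ≤ v
    · have hf := hfisher hv
      have hl : lam = (a : ℤ) + b + c - v := by push_cast at hGS; linarith
      subst hl
      have hf' : ((a : ℚ) * (a - 1) + b * (b - 1) + c * (c - 1)) =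
          (a + b + c - v) * (v - 1) := by exact_mod_cast hf
      linear_combination hf'
    · have hv1 : v = 1 := by omega
      have hc : c = 0 := by omega
      have hb : b = 0 := by omega
      have ha : a = 0 := by omega
      subst hv1 hc hb ha
      norm_num
  refine ⟨key, ?_⟩
  have hn : (0 : ℚ) ≤ (Fintype.card G : ℚ) / 4 * (4 - (Fintype.card G : ℚ)) := by
    rw [← key]
    exact Finset.sum_nonneg fun i _ => sq_nonneg _
  have hp : (0 : ℚ) < (Fintype.card G : ℚ) / 4 := by positivity
  have h4 := nonneg_of_mul_nonneg_right hn hp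
  have h5 : (Fintype.card G : ℚ) ≤ 4 := by linarith
  exact_mod_cast h5
end
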